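/- Suppose ⟨σ₀,…,σₙ⟩ ≈_γ ⟨τ₀,…,τₙ⟩ are tuples of nonempty finite binary strings. Then for all i, j, k, l ≤ n and d ∈ {0,1}: (σᵢ⁻∧σⱼ⁻)⌢⟨d⟩ ⊴ σ_k⁻∧σ_l⁻ if and only if (τᵢ⁻∧τⱼ⁻)⌢⟨d⟩ ⊴ τ_k⁻∧τ_l⁻. (Subclaim 2 in the proof of Lemma 3.6.) -/

import Mathlib

/-- The meet `η ∧ ν` of two finite binary strings: their longest common prefix. -/
def lcp : List Bool → List Bool → List Bool
  | a :: as, b :: bs => if a = b then a :: lcp as bs else []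
  | _, _ => []

/-- `η ⊥ ν`: the strings are incomparable (neither is a prefix of the other). -/
def Incomp (a b : List Bool) : Prop := ¬ a <+: b ∧ ¬ b <+: a

/-- A tuple of strings is ∧-closed if the meet of any two entries is again an entry. -/
def MeetClosed {ι : Type*} (t : ι → List Bool) : Prop :=
  ∀ i j : ι, ∃ k : ι, lcp (t i) (t j) = t k

/-- `s ≈_α t`: both tuples are ∧-closed, and they satisfy the same
`⊴`-relations and the same `⌢⟨d⟩⊴`-relations between entries. -/
def EqvA {ι : Type*} (s t : ι → List Bool) : Prop :=
  MeetClosed s ∧ MeetClosed t ∧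
  (∀ i j : ι, s i <+: s j ↔ t i <+: t j) ∧
  (∀ (i j : ι) (d : Bool), s i ++ [d] <+: s j ↔ t i ++ [d] <+: t j)

/-- `s ≈_β t`: `≈_α` together with preservation of the relation `ηᵢ⌢⟨1⟩ = ηⱼ`. -/
def EqvB {ι : Type*} (s t : ι → List Bool) : Prop :=
  EqvA s t ∧ ∀ i j : ι, s i ++ [true] = s j ↔ t i ++ [true] = t j

/-- `s ≈_γ t`: `≈_β` together with preservation of `ηᵢ⌢⟨0⟩ = ηⱼ` and of
ending with `0` resp. with `1`. -/
def EqvG {ι : Type*} (s t : ι → List Bool) : Prop :=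
  EqvB s t ∧
  (∀ i j : ι, s i ++ [false] = s j ↔ t i ++ [false] = t j) ∧
  (∀ i : ι, (s i).getLast? = some false ↔ (t i).getLast? = some false) ∧
  (∀ i : ι, (s i).getLast? = some true ↔ (t i).getLast? = some true)

/-- The meet-closure tuple of a tuple of strings: all pairwise meets. -/
def cl {ι : Type*} (t : ι → List Bool) : ι × ι → List Bool :=
  fun p => lcp (t p.1) (t p.2)

theorem prefix_lcp_iff {p a b : List Bool} : p <+: lcp a b ↔ p <+: a ∧ p <+: b := by
  induction a generalizing p b with
  | nil => cases b <;> simp +contextual [lcp]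
  | cons x a ih =>
    cases b with
    | nil => simp +contextual [lcp]
    | cons y b =>
      cases p with
      | nil => simp
      | cons z p =>
        by_cases hxy : x = y
        · subst hxy
          simp only [lcp, if_true, List.cons_prefix_cons, ih]
          tauto
        · simp only [lcp, if_neg hxy, List.cons_prefix_cons]
          simp only [List.prefix_nil, reduceCtorEq, false_iff]
          rintro ⟨⟨rfl, -⟩, rfl, -⟩
          exact hxy rfl

theorem lcp_prefix_left (a b : List Bool) : lcp a b <+: a :=
  (prefix_lcp_iff.1 List.prefix_rfl).1

theorem lcp_prefix_right (a b : List Bool) : lcp a b <+: b :=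
  (prefix_lcp_iff.1 List.prefix_rfl).2

theorem eq_of_prefix_of_prefix {a b : List Bool} (h : a <+: b) (h' : b <+: a) : a = b :=
  h.eq_of_length (le_antisymm h.length_le h'.length_le)

theorem lcp_comm (a b : List Bool) : lcp a b = lcp b a :=
  eq_of_prefix_of_prefix (prefix_lcp_iff.2 ⟨lcp_prefix_right a b, lcp_prefix_left a b⟩)
    (prefix_lcp_iff.2 ⟨lcp_prefix_right b a, lcp_prefix_left b a⟩)

theorem lcp_eq_left {a b : List Bool} (h : a <+: b) : lcp a b = a :=
  eq_of_prefix_of_prefix (lcp_prefix_left a b) (prefix_lcp_iff.2 ⟨List.prefix_rfl, h⟩)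

theorem eq_or_exists_concat_prefix {p a : List Bool} (h : p <+: a) :
    p = a ∨ ∃ d, p ++ [d] <+: a := by
  obtain ⟨t, rfl⟩ := h
  cases t with
  | nil => simp
  | cons d t => exact Or.inr ⟨d, t, by simp⟩

theorem concat_prefix_inj {p a : List Bool} {d e : Bool}
    (hd : p ++ [d] <+: a) (he : p ++ [e] <+: a) : d = e := by
  have h := List.prefix_of_prefix_length_le hd he (by simp)
  simpa using h.eq_of_length (by simp)

theorem not_concat_prefix_self (p : List Bool) (d : Bool) : ¬ p ++ [d] <+: p := fun h => by
  have := h.length_le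
  simp at this

theorem exists_branch_of_incomp {a b : List Bool} (h : Incomp a b) :
    ∃ d, lcp a b ++ [d] <+: a ∧ lcp a b ++ [!d] <+: b := by
  rcases eq_or_exists_concat_prefix (lcp_prefix_left a b) with ha | ⟨d, hd⟩
  · exact absurd (ha ▸ lcp_prefix_right a b) h.1
  rcases eq_or_exists_concat_prefix (lcp_prefix_right a b) with hb | ⟨e, he⟩
  · exact absurd (hb ▸ lcp_prefix_left a b) h.2
  refine ⟨d, hd, ?_⟩
  have hne : e ≠ d := by
    rintro rfl
    exact not_concat_prefix_self _ _ (prefix_lcp_iff.2 ⟨hd, he⟩)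
  rwa [← Bool.eq_not.2 hne]

theorem prefix_dropLast_iff {p a : List Bool} (ha : a ≠ []) :
    p <+: a.dropLast ↔ p <+: a ∧ p ≠ a := by
  constructor
  · intro h
    refine ⟨h.trans (List.dropLast_prefix a), ?_⟩
    rintro rfl
    have h1 := h.length_le
    have h2 := List.length_pos_iff.2 ha
    simp only [List.length_dropLast] at h1
    omega
  · rintro ⟨h, hne⟩
    refine List.prefix_of_prefix_length_le h (List.dropLast_prefix a) ?_
    have h1 : p.length ≠ a.length := fun e => hne (h.eq_of_length e)
    have h2 := h.length_le
    simp only [List.length_dropLast]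
    omega

theorem lcp_dropLast_of_prefix {a b : List Bool} (ha : a ≠ []) (hb : b ≠ []) (h : a <+: b) :
    lcp a.dropLast b.dropLast = a.dropLast := by
  refine lcp_eq_left ((prefix_dropLast_iff hb).2 ⟨(List.dropLast_prefix a).trans h, ?_⟩)
  intro e
  have h1 := h.length_le
  have h2 := congrArg List.length e
  have h3 := List.length_pos_iff.2 ha
  simp only [List.length_dropLast] at h2
  omega

theorem lcp_dropLast_of_branch {p a b : List Bool} {d : Bool}
    (ha : p ++ [d] <+: a) (hb : p ++ [!d] <+: b) : lcp a.dropLast b.dropLast = p := by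
  have key : ∀ {c : List Bool} {e : Bool}, p ++ [e] <+: c → p <+: c.dropLast := by
    intro c e hc
    have hne : c ≠ [] := by
      rintro rfl
      simp at hc
    refine (prefix_dropLast_iff hne).2 ⟨(List.prefix_append _ _).trans hc, ?_⟩
    rintro rfl
    exact not_concat_prefix_self _ _ hc
  rcases eq_or_exists_concat_prefix (prefix_lcp_iff.2 ⟨key ha, key hb⟩) with h | ⟨e, he⟩
  · exact h.symm
  · have h1 := concat_prefix_inj ha
      ((he.trans (lcp_prefix_left _ _)).trans (List.dropLast_prefix a))
    have h2 := concat_prefix_inj hb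
      ((he.trans (lcp_prefix_right _ _)).trans (List.dropLast_prefix b))
    cases d <;> simp_all

theorem lcp_eq_of_branch {p a b : List Bool} {d : Bool}
    (ha : p ++ [d] <+: a) (hb : p ++ [!d] <+: b) : lcp a b = p := by
  have hp : p <+: lcp a b := prefix_lcp_iff.2
    ⟨(List.prefix_append _ _).trans ha, (List.prefix_append _ _).trans hb⟩
  rcases eq_or_exists_concat_prefix hp with h | ⟨e, he⟩
  · exact h.symm
  · have h1 := concat_prefix_inj ha (he.trans (lcp_prefix_left _ _))
    have h2 := concat_prefix_inj hb (he.trans (lcp_prefix_right _ _))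
    cases d <;> simp_all

namespace EqvG

variable {ι : Type*} {s t : ι → List Bool}

theorem symm (h : EqvG s t) : EqvG t s := by
  obtain ⟨⟨⟨h1, h2, h3, h4⟩, h5⟩, h6, h7, h8⟩ := h
  exact ⟨⟨⟨h2, h1, fun i j => (h3 i j).symm, fun i j d => (h4 i j d).symm⟩,
    fun i j => (h5 i j).symm⟩, fun i j => (h6 i j).symm, fun i => (h7 i).symm,
    fun i => (h8 i).symm⟩

theorem concat_eq_iff (h : EqvG s t) (i j : ι) (d : Bool) :
    s i ++ [d] = s j ↔ t i ++ [d] = t j := by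
  cases d
  · exact h.2.1 i j
  · exact h.1.2 i j

theorem eq_iff (h : EqvG s t) (i j : ι) : s i = s j ↔ t i = t j := by
  have h3 := h.1.1.2.2.1
  constructor
  · intro e
    exact eq_of_prefix_of_prefix ((h3 i j).1 (e ▸ List.prefix_rfl))
      ((h3 j i).1 (e ▸ List.prefix_rfl))
  · intro e
    exact eq_of_prefix_of_prefix ((h3 i j).2 (e ▸ List.prefix_rfl))
      ((h3 j i).2 (e ▸ List.prefix_rfl))

theorem getLast?_iff (h : EqvG s t) (i : ι) (d : Bool) :
    (s i).getLast? = some d ↔ (t i).getLast? = some d := by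
  cases d
  · exact h.2.2.1 i
  · exact h.2.2.2 i

/-- The meet of two truncated entries is an entry or a truncated entry, at an index that
is the same for both tuples. -/
theorem exists_lcp_dropLast (h : EqvG s t) (hs : ∀ i, s i ≠ []) (ht : ∀ i, t i ≠ []) (i j : ι) :
    ∃ m, (lcp (s i).dropLast (s j).dropLast = s m ∧ lcp (t i).dropLast (t j).dropLast = t m) ∨
      (lcp (s i).dropLast (s j).dropLast = (s m).dropLast ∧
        lcp (t i).dropLast (t j).dropLast = (t m).dropLast) := by
  have h3 := h.1.1.2.2.1
  have h4 := h.1.1.2.2.2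
  by_cases hij : s i <+: s j
  · exact ⟨i, Or.inr ⟨lcp_dropLast_of_prefix (hs i) (hs j) hij,
      lcp_dropLast_of_prefix (ht i) (ht j) ((h3 i j).1 hij)⟩⟩
  by_cases hji : s j <+: s i
  · refine ⟨j, Or.inr ⟨?_, ?_⟩⟩
    · rw [lcp_comm, lcp_dropLast_of_prefix (hs j) (hs i) hji]
    · rw [lcp_comm, lcp_dropLast_of_prefix (ht j) (ht i) ((h3 j i).1 hji)]
  obtain ⟨d, hi, hj⟩ := exists_branch_of_incomp ⟨hij, hji⟩
  obtain ⟨m, hm⟩ := h.1.1.1 i j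
  rw [hm] at hi hj
  exact ⟨m, Or.inl ⟨lcp_dropLast_of_branch hi hj,
    lcp_dropLast_of_branch ((h4 _ _ _).1 hi) ((h4 _ _ _).1 hj)⟩⟩

/-- If `s a` truncated and extended by `d` is a prefix of `s b`, then either `s a` ends with `d`
or the truncation of `s a` is itself an entry; both situations transfer to `t`. -/
theorem dropLast_concat_transfer (h : EqvG s t) (hs : ∀ i, s i ≠ []) {a b : ι}
    {d : Bool} (hab : (s a).dropLast ++ [d] <+: s b) :
    ∃ m, (s m = (s a).dropLast ++ [d] ∧ t m = (t a).dropLast ++ [d]) ∨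
      (s m = (s a).dropLast ∧ t m = (t a).dropLast) := by
  have hsa := List.dropLast_append_getLast (hs a)
  set e := (s a).getLast (hs a)
  by_cases hed : e = d
  · refine ⟨a, Or.inl ⟨by rw [← hed, hsa], ?_⟩⟩
    have hl : (s a).getLast? = some d := by rw [← hsa]; simp [hed]
    exact (List.dropLast_append_getLast? d ((h.getLast?_iff a d).1 hl)).symm
  · have he : d = !e := by cases d <;> cases he : e <;> simp_all
    have hm' : lcp (s a) (s b) = (s a).dropLast :=
      lcp_eq_of_branch (d := e) (by rw [hsa]) (he ▸ hab)
    obtain ⟨m, hm⟩ := h.1.1.1 a b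
    have hsm : s m = (s a).dropLast := hm ▸ hm'
    refine ⟨m, Or.inr ⟨hsm, ?_⟩⟩
    have := (h.concat_eq_iff m a e).1 (by rw [hsm, hsa])
    rw [← this]; simp

theorem prefix_lcp_dropLast (h : EqvG s t) (hs : ∀ i, s i ≠ []) (ht : ∀ i, t i ≠ [])
    {i j k l : ι} {d : Bool}
    (hp : lcp (s i).dropLast (s j).dropLast ++ [d] <+: lcp (s k).dropLast (s l).dropLast) :
    lcp (t i).dropLast (t j).dropLast ++ [d] <+: lcp (t k).dropLast (t l).dropLast := by
  have h3 := h.1.1.2.2.1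
  have h4 := h.1.1.2.2.2
  obtain ⟨a, ⟨h5, h6⟩ | ⟨h5, h6⟩⟩ := h.exists_lcp_dropLast hs ht i j <;>
  obtain ⟨b, ⟨h7, h8⟩ | ⟨h7, h8⟩⟩ := h.exists_lcp_dropLast hs ht k l <;>
  rw [h5, h7] at hp <;> rw [h6, h8]
  · exact (h4 a b d).1 hp
  · rw [prefix_dropLast_iff (hs b)] at hp
    rw [prefix_dropLast_iff (ht b)]
    exact ⟨(h4 a b d).1 hp.1, fun e => hp.2 ((h.concat_eq_iff a b d).2 e)⟩
  · obtain ⟨m, ⟨h9, h10⟩ | ⟨h9, h10⟩⟩ := h.dropLast_concat_transfer hs hp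
    · rw [← h9] at hp
      rw [← h10]
      exact (h3 m b).1 hp
    · rw [← h9] at hp
      rw [← h10]
      exact (h4 m b d).1 hp
  · rw [prefix_dropLast_iff (hs b)] at hp
    rw [prefix_dropLast_iff (ht b)]
    obtain ⟨m, ⟨h9, h10⟩ | ⟨h9, h10⟩⟩ := h.dropLast_concat_transfer hs hp.1
    · rw [← h9] at hp
      rw [← h10]
      exact ⟨(h3 m b).1 hp.1, fun e => hp.2 ((h.eq_iff m b).2 e)⟩
    · rw [← h9] at hp
      rw [← h10]
      exact ⟨(h4 m b d).1 hp.1, fun e => hp.2 ((h.concat_eq_iff m b d).2 e)⟩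

end EqvG


/-- Subclaim 2 in the proof of Lemma 3.6. -/
theorem stmt8 {n : ℕ} (σ τ : Fin (n + 1) → List Bool)
    (hσne : ∀ i, σ i ≠ []) (hτne : ∀ i, τ i ≠ [])
    (h : EqvG σ τ) :
    ∀ (i j k l : Fin (n + 1)) (d : Bool),
      (lcp ((σ i).dropLast) ((σ j).dropLast) ++ [d] <+:
        lcp ((σ k).dropLast) ((σ l).dropLast)) ↔
      (lcp ((τ i).dropLast) ((τ j).dropLast) ++ [d] <+:
        lcp ((τ k).dropLast) ((τ l).dropLast)) := by
  intro i j k l d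
  exact ⟨h.prefix_lcp_dropLast hσne hτne, h.symm.prefix_lcp_dropLast hτne hσne⟩
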